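/- arXiv:2012.05656 — 2 statements merged into one kernel-verified Lean document; each statement's English description precedes it below -/
import Mathlib

section
/- Let G = (V, E) be a finite simple graph on n(G) vertices. Then hn_cc(G) = n(G) if, and only if, G is a forest (i.e. G has no cycle). -/
open SimpleGraph

/-- The cycle-convexity interval function: `Icc G S` adds to `S` every vertex `v`
lying on a cycle of the subgraph of `G` induced by `S ∪ {v}`. -/
def Icc {V : Type*} (G : SimpleGraph V) (S : Set V) : Set V :=
  S ∪ {v | ∃ w : (G.induce (insert v S)).Walk ⟨v, Set.mem_insert v S⟩ ⟨v, Set.mem_insert v S⟩,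
        w.IsCycle}

/-- A set is convex in the cycle convexity if it is `Icc`-closed. -/
def CcConvex {V : Type*} (G : SimpleGraph V) (S : Set V) : Prop := Icc G S = S

/-- The convex hull of `S` in the cycle convexity: the smallest convex set containing `S`. -/
def ccHull {V : Type*} (G : SimpleGraph V) (S : Set V) : Set V :=
  ⋂₀ {T : Set V | S ⊆ T ∧ CcConvex G T}

/-- A hull set in the cycle convexity. -/
def IsHullSet {V : Type*} (G : SimpleGraph V) (S : Set V) : Prop := ccHull G S = Set.univ

/-- The hull number in the cycle convexity: minimum cardinality of a hull set. -/
noncomputable def hnCC {V : Type*} (G : SimpleGraph V) : ℕ :=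
  sInf {n | ∃ S : Set V, S.ncard = n ∧ IsHullSet G S}

theorem ccConvex_of_isAcyclic {V : Type*} {G : SimpleGraph V} (hG : G.IsAcyclic) (S : Set V) :
    CcConvex G S := by
  refine Set.union_eq_self_of_subset_right ?_
  rintro v ⟨w, hw⟩
  exact (hG.induce _ w hw).elim

theorem subset_ccHull {V : Type*} (G : SimpleGraph V) (S : Set V) : S ⊆ ccHull G S :=
  Set.subset_sInter fun _ hT => hT.1

theorem isHullSet_univ {V : Type*} (G : SimpleGraph V) : IsHullSet G Set.univ :=
  Set.univ_subset_iff.mp (subset_ccHull G Set.univ)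

theorem isHullSet_iff_eq_univ_of_isAcyclic {V : Type*} {G : SimpleGraph V} (hG : G.IsAcyclic)
    {S : Set V} : IsHullSet G S ↔ S = Set.univ := by
  refine ⟨fun h => ?_, fun h => h ▸ isHullSet_univ G⟩
  have hS : ccHull G S ⊆ S :=
    Set.sInter_subset_of_mem ⟨subset_rfl, ccConvex_of_isAcyclic hG S⟩
  rw [IsHullSet] at h
  exact Set.univ_subset_iff.mp (h ▸ hS)

theorem mem_Icc_compl_singleton_of_isCycle {V : Type*} {G : SimpleGraph V} {v : V}
    {c : G.Walk v v} (hc : c.IsCycle) : v ∈ Icc G {v}ᶜ := by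
  have hmem : ∀ x, x ∈ insert v ({v}ᶜ : Set V) := fun x => by
    by_cases hx : x = v <;> simp [hx]
  let f : G →g G.induce (insert v {v}ᶜ) := ⟨fun x => ⟨x, hmem x⟩, fun h => h⟩
  have hf : Function.Injective f := fun _ _ h => congrArg Subtype.val h
  exact Or.inr ⟨c.map f, hc.map hf⟩

theorem isHullSet_compl_singleton_of_isCycle {V : Type*} {G : SimpleGraph V} {v : V}
    {c : G.Walk v v} (hc : c.IsCycle) : IsHullSet G {v}ᶜ := by
  refine Set.eq_univ_of_forall fun x => Set.mem_sInter.mpr ?_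
  rintro T ⟨hvT, hT⟩
  have hv : v ∈ T := by
    by_contra hv
    have hTv : T = {v}ᶜ := (Set.subset_compl_singleton_iff.mpr hv).antisymm hvT
    have h := mem_Icc_compl_singleton_of_isCycle hc
    rw [← hTv, hT] at h
    exact hv h
  by_cases hx : x = v
  · exact hx ▸ hv
  · exact hvT hx

/-- `hn_cc(G) = n(G)` iff `G` is a forest. -/
theorem hnCC_eq_card_iff_isAcyclic {V : Type*} [Fintype V] (G : SimpleGraph V) :
    hnCC G = Fintype.card V ↔ G.IsAcyclic := by
  constructor
  · intro h v c hc
    have hle : hnCC G ≤ ({v}ᶜ : Set V).ncard :=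
      Nat.sInf_le ⟨_, rfl, isHullSet_compl_singleton_of_isCycle hc⟩
    have hlt : ({v}ᶜ : Set V).ncard < Nat.card V :=
      Set.ncard_lt_card (Set.compl_ne_univ.mpr (Set.singleton_nonempty v))
    rw [Nat.card_eq_fintype_card] at hlt
    omega
  · intro hG
    simp [hnCC, isHullSet_iff_eq_univ_of_isAcyclic hG, Set.ncard_univ]
end

section
/- Let G be a finite connected simple graph, u a cut-vertex of G, and C the vertex set of some connected component of G − u. Let G₁ = G[C ∪ {u}] and G₂ = G − C (the subgraph induced by V(G) \ C). Then hn_cc(G₁) + hn_cc(G₂) − 1 ≤ hn_cc(G) ≤ hn_cc(G₁) + hn_cc(G₂). -/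
open SimpleGraph

/-- `A` and `B` cover the graph, meet exactly in `u`, and an edge can leave `A` or `B`
only through `u`. -/
structure IsOneSeparation {V : Type*} (G : SimpleGraph V) (u : V) (A B : Set V) : Prop where
  union_eq : A ∪ B = Set.univ
  inter_eq : A ∩ B = {u}
  adj_left : ∀ x y, G.Adj x y → x ∈ A → x ≠ u → y ∈ A
  adj_right : ∀ x y, G.Adj x y → x ∈ B → x ≠ u → y ∈ B

theorem IsOneSeparation.symm {V : Type*} {G : SimpleGraph V} {u : V} {A B : Set V}
    (h : IsOneSeparation G u A B) : IsOneSeparation G u B A where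
  union_eq := Set.union_comm B A ▸ h.union_eq
  inter_eq := Set.inter_comm B A ▸ h.inter_eq
  adj_left := h.adj_right
  adj_right := h.adj_left

theorem isHullSet_iff {V : Type*} {G : SimpleGraph V} {S : Set V} :
    IsHullSet G S ↔ ∀ T, S ⊆ T → CcConvex G T → T = Set.univ := by
  simp only [IsHullSet, ccHull, Set.sInter_eq_univ, Set.mem_ofPred_eq, and_imp]

theorem hnCC_le_ncard {V : Type*} {G : SimpleGraph V} {S : Set V} (h : IsHullSet G S) :
    hnCC G ≤ S.ncard :=
  Nat.sInf_le ⟨S, rfl, h⟩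

theorem exists_isHullSet_ncard_eq_hnCC {V : Type*} (G : SimpleGraph V) :
    ∃ S : Set V, S.ncard = hnCC G ∧ IsHullSet G S :=
  Nat.sInf_mem (s := {n | ∃ S : Set V, S.ncard = n ∧ IsHullSet G S})
    ⟨_, Set.univ, rfl, isHullSet_iff.2 fun _ hT _ => Set.univ_subset_iff.1 hT⟩

theorem exists_isCycle_of_induce {V : Type*} {G : SimpleGraph V} {s : Set V} {v : s}
    (w : (G.induce s).Walk v v) (hw : w.IsCycle) :
    ∃ c : G.Walk v v, c.IsCycle ∧ c.support = w.support.map Subtype.val :=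
  ⟨w.map (Embedding.induce s).toHom, hw.map (Embedding.induce (G := G) s).injective,
    Walk.support_map ..⟩

theorem exists_isCycle_induce {V : Type*} {G : SimpleGraph V} {s : Set V} {v : V}
    (w : G.Walk v v) (hw : w.IsCycle) (hs : ∀ x ∈ w.support, x ∈ s) :
    ∃ c : (G.induce s).Walk ⟨v, hs v w.start_mem_support⟩ ⟨v, hs v w.start_mem_support⟩,
      c.IsCycle ∧ c.support.map Subtype.val = w.support := by
  have hmap := Walk.map_induce w hs
  refine ⟨w.induce s hs, ?_, ?_⟩
  · refine (Walk.isCycle_map_iff_of_injective (f := (Embedding.induce (G := G) s).toHom)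
      (Embedding.induce (G := G) s).injective).1 ?_
    exact hmap.symm ▸ hw
  · conv_rhs => rw [← hmap]
    exact (Walk.support_map (Embedding.induce (G := G) s).toHom (w.induce s hs)).symm

theorem ccConvex_iff {V : Type*} {G : SimpleGraph V} {S : Set V} :
    CcConvex G S ↔ ∀ (v : V) (w : G.Walk v v), w.IsCycle →
      (∀ x ∈ w.support, x ∈ insert v S) → v ∈ S := by
  rw [CcConvex, Icc, Set.union_eq_left]
  constructor
  · intro h v w hw hs
    obtain ⟨c, hc, -⟩ := exists_isCycle_induce w hw hs
    exact h ⟨c, hc⟩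
  · rintro h v ⟨w, hw⟩
    obtain ⟨c, hc, hsupp⟩ := exists_isCycle_of_induce w hw
    refine h v c hc fun x hx => ?_
    rw [hsupp, List.mem_map] at hx
    obtain ⟨y, -, rfl⟩ := hx
    exact y.2

theorem ccConvex_induce_iff {V : Type*} {G : SimpleGraph V} {A T : Set V} :
    CcConvex (G.induce A) (Subtype.val ⁻¹' T) ↔ ∀ (v : V) (w : G.Walk v v), w.IsCycle →
      (∀ x ∈ w.support, x ∈ A) → (∀ x ∈ w.support, x ∈ insert v T) → v ∈ T := by
  rw [ccConvex_iff]
  constructor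
  · intro h v w hw hA hs
    obtain ⟨c, hc, hsupp⟩ := exists_isCycle_induce w hw hA
    refine h _ c hc fun x hx => ?_
    simpa [Subtype.ext_iff] using hs x (hsupp ▸ List.mem_map_of_mem hx)
  · rintro h v w hw hs
    obtain ⟨c, hc, hsupp⟩ := exists_isCycle_of_induce w hw
    refine h v c hc ?_ ?_ <;> simp only [hsupp, List.forall_mem_map]
    · exact fun y _ => y.2
    · exact fun y hy => (hs y hy).imp (congrArg _) id

theorem CcConvex.induce {V : Type*} {G : SimpleGraph V} {T : Set V} (hT : CcConvex G T)
    (A : Set V) : CcConvex (G.induce A) (Subtype.val ⁻¹' T) :=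
  ccConvex_induce_iff.2 fun v w hw _ hs => ccConvex_iff.1 hT v w hw hs

theorem support_subset_of_not_mem {V : Type*} {G : SimpleGraph V} {u : V} {A : Set V}
    (hA : ∀ x y, G.Adj x y → x ∈ A → x ≠ u → y ∈ A) {a b : V} (p : G.Walk a b) (ha : a ∈ A)
    (hu : u ∉ p.support) : ∀ x ∈ p.support, x ∈ A := by
  induction p with
  | nil => simpa using ha
  | cons h p ih =>
    simp only [Walk.support_cons, List.mem_cons, not_or] at hu
    simp only [Walk.support_cons, List.forall_mem_cons]
    exact ⟨ha, ih (hA _ _ h ha (Ne.symm hu.1)) hu.2⟩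

theorem support_subset_of_isPath {V : Type*} {G : SimpleGraph V} {u : V} {A : Set V}
    (hA : ∀ x y, G.Adj x y → x ∈ A → x ≠ u → y ∈ A) {a : V} (p : G.Walk a u) (ha : a ∈ A)
    (hp : p.IsPath) : ∀ x ∈ p.support, x ∈ A := by
  induction p with
  | nil => simpa using ha
  | cons h p ih =>
    rw [Walk.cons_isPath_iff] at hp
    simp only [Walk.support_cons, List.forall_mem_cons]
    exact ⟨ha, ih hA (hA _ _ h ha fun e => hp.2 (e ▸ p.end_mem_support)) hp.1⟩

theorem IsOneSeparation.mem_or_mem {V : Type*} {G : SimpleGraph V} {u : V} {A B : Set V}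
    (h : IsOneSeparation G u A B) (x : V) : x ∈ A ∨ x ∈ B :=
  (Set.eq_univ_iff_forall.1 h.union_eq x :)

theorem IsOneSeparation.mem_left {V : Type*} {G : SimpleGraph V} {u : V} {A B : Set V}
    (h : IsOneSeparation G u A B) : u ∈ A :=
  (h.inter_eq.symm ▸ Set.mem_singleton u : u ∈ A ∩ B).1

theorem IsOneSeparation.eq_of_mem {V : Type*} {G : SimpleGraph V} {u x : V} {A B : Set V}
    (h : IsOneSeparation G u A B) (hA : x ∈ A) (hB : x ∈ B) : x = u := by
  have : x ∈ A ∩ B := ⟨hA, hB⟩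
  rwa [h.inter_eq] at this

/-- A cycle lies on one side of a one-vertex separation. -/
theorem IsOneSeparation.cycle_subset {V : Type*} {G : SimpleGraph V} {u : V} {A B : Set V}
    (h : IsOneSeparation G u A B) {v : V} (w : G.Walk v v) (hw : w.IsCycle) :
    (∀ x ∈ w.support, x ∈ A) ∨ (∀ x ∈ w.support, x ∈ B) := by
  classical
  by_cases hu : u ∈ w.support
  · have hc := hw.rotate hu
    have hs : ∀ x, x ∈ w.support → x ∈ (w.rotate _ hu).support := fun x hx =>
      (Walk.mem_support_rotate_iff ..).2 hx
    generalize w.rotate _ hu = c at hc hs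
    cases c with
    | nil => exact absurd hc Walk.not_isCycle_nil
    | cons e p =>
      have hp := ((Walk.cons_isCycle_iff _ _).1 hc).1
      rcases h.mem_or_mem _ with hA | hB
      · refine Or.inl fun x hx => support_subset_of_isPath h.adj_left p hA hp x ?_
        have := hs x hx
        simp only [Walk.support_cons, List.mem_cons] at this
        exact this.elim (fun e => e ▸ p.end_mem_support) id
      · refine Or.inr fun x hx => support_subset_of_isPath h.adj_right p hB hp x ?_
        have := hs x hx
        simp only [Walk.support_cons, List.mem_cons] at this
        exact this.elim (fun e => e ▸ p.end_mem_support) id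
  · exact (h.mem_or_mem v).imp (support_subset_of_not_mem h.adj_left w · hu)
      (support_subset_of_not_mem h.adj_right w · hu)

/-- Convex sets on the two sides that agree at `u` glue to a convex set; so if they contain the
traces of a hull set, they are both everything. -/
theorem IsOneSeparation.eq_univ_of_isHullSet {V : Type*} {G : SimpleGraph V} {u : V} {A B : Set V}
    (h : IsOneSeparation G u A B) {S : Set V} (hS : IsHullSet G S) {T₁ T₂ : Set V}
    (hA : CcConvex (G.induce A) (Subtype.val ⁻¹' T₁))
    (hB : CcConvex (G.induce B) (Subtype.val ⁻¹' T₂))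
    (hSA : S ∩ A ⊆ T₁) (hSB : S ∩ B ⊆ T₂) (hu : u ∈ T₁ ↔ u ∈ T₂) : A ⊆ T₁ ∧ B ⊆ T₂ := by
  have key₁ : ∀ x ∈ A, x ∈ (T₁ ∩ A) ∪ (T₂ ∩ B) ↔ x ∈ T₁ := by
    refine fun x hx => ⟨?_, fun hxT => Or.inl ⟨hxT, hx⟩⟩
    rintro (hx' | hx')
    · exact hx'.1
    · obtain rfl := h.eq_of_mem hx hx'.2
      exact hu.2 hx'.1
  have key₂ : ∀ x ∈ B, x ∈ (T₁ ∩ A) ∪ (T₂ ∩ B) ↔ x ∈ T₂ := by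
    refine fun x hx => ⟨?_, fun hxT => Or.inr ⟨hxT, hx⟩⟩
    rintro (hx' | hx')
    · obtain rfl := h.eq_of_mem hx'.2 hx
      exact hu.1 hx'.1
    · exact hx'.1
  have huniv : (T₁ ∩ A) ∪ (T₂ ∩ B) = Set.univ := by
    refine isHullSet_iff.1 hS _ ?_ (ccConvex_iff.2 fun v w hw hs => ?_)
    · exact fun x hx => (h.mem_or_mem x).imp (fun hxA => ⟨hSA ⟨hx, hxA⟩, hxA⟩)
        fun hxB => ⟨hSB ⟨hx, hxB⟩, hxB⟩
    · rcases h.cycle_subset w hw with hwA | hwB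
      · exact (key₁ v (hwA v w.start_mem_support)).2 (ccConvex_induce_iff.1 hA v w hw hwA
          fun x hx => (hs x hx).imp id (key₁ x (hwA x hx)).1)
      · exact (key₂ v (hwB v w.start_mem_support)).2 (ccConvex_induce_iff.1 hB v w hw hwB
          fun x hx => (hs x hx).imp id (key₂ x (hwB x hx)).1)
  exact ⟨fun x hx => (key₁ x hx).1 (huniv ▸ Set.mem_univ x),
    fun x hx => (key₂ x hx).1 (huniv ▸ Set.mem_univ x)⟩

theorem isHullSet_induce_iff {V : Type*} {G : SimpleGraph V} {A S : Set V} :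
    IsHullSet (G.induce A) (Subtype.val ⁻¹' S) ↔
      ∀ T : Set V, S ∩ A ⊆ T → CcConvex (G.induce A) (Subtype.val ⁻¹' T) → A ⊆ T := by
  rw [isHullSet_iff]
  constructor
  · intro h T hST hT x hx
    have := h _ (fun y hy => hST ⟨hy, y.2⟩) hT
    exact (Set.eq_univ_iff_forall.1 this ⟨x, hx⟩ :)
  · intro h T hST hT
    have hpre : (Subtype.val ⁻¹' (Subtype.val '' T) : Set A) = T :=
      Set.preimage_image_eq _ Subtype.val_injective
    have := h (Subtype.val '' T) (fun x hx => ⟨⟨x, hx.2⟩, hST hx.1, rfl⟩) (by rwa [hpre])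
    rw [← hpre]
    exact Set.eq_univ_of_forall fun x => this x.2

theorem IsOneSeparation.isHullSet_insert {V : Type*} {G : SimpleGraph V} {u : V} {A B : Set V}
    (h : IsOneSeparation G u A B) {S : Set V} (hS : IsHullSet G S) :
    IsHullSet (G.induce A) (Subtype.val ⁻¹' insert u S) := by
  rw [isHullSet_induce_iff]
  intro T hST hT
  have hu : u ∈ T := hST ⟨Set.mem_insert u S, h.mem_left⟩
  refine (h.eq_univ_of_isHullSet hS hT (T₂ := Set.univ) ?_ ?_ (Set.subset_univ _)
    (by simp [hu])).1
  · exact ccConvex_iff.2 fun _ _ _ _ => trivial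
  · exact fun x hx => hST ⟨Set.mem_insert_of_mem u hx.1, hx.2⟩

theorem IsOneSeparation.isHullSet_or {V : Type*} {G : SimpleGraph V} {u : V} {A B : Set V}
    (h : IsOneSeparation G u A B) {S : Set V} (hS : IsHullSet G S) :
    IsHullSet (G.induce A) (Subtype.val ⁻¹' S) ∨ IsHullSet (G.induce B) (Subtype.val ⁻¹' S) := by
  simp only [isHullSet_induce_iff]
  by_contra! hcon
  obtain ⟨⟨T₁, hS₁, hT₁, hA⟩, T₂, hS₂, hT₂, hB⟩ := hcon
  have hu₁ : u ∉ T₁ := fun hu => hA <| isHullSet_induce_iff.1 (h.isHullSet_insert hS) T₁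
    (by rintro x ⟨rfl | hx, hxA⟩; exacts [hu, hS₁ ⟨hx, hxA⟩]) hT₁
  have hu₂ : u ∉ T₂ := fun hu => hB <| isHullSet_induce_iff.1 (h.symm.isHullSet_insert hS) T₂
    (by rintro x ⟨rfl | hx, hxB⟩; exacts [hu, hS₂ ⟨hx, hxB⟩]) hT₂
  exact hA (h.eq_univ_of_isHullSet hS hT₁ hT₂ hS₁ hS₂ (by simp [hu₁, hu₂])).1

theorem ncard_preimage_val {V : Type*} (A S : Set V) :
    (Subtype.val ⁻¹' S : Set A).ncard = (S ∩ A).ncard := by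
  rw [← Set.ncard_image_of_injective _ Subtype.val_injective, Subtype.image_preimage_coe,
    Set.inter_comm]

theorem IsOneSeparation.hnCC_add_le {V : Type*} [Finite V] {G : SimpleGraph V} {u : V}
    {A B : Set V} (h : IsOneSeparation G u A B) :
    hnCC (G.induce A) + hnCC (G.induce B) ≤ hnCC G + 1 := by
  obtain ⟨S, hcard, hS⟩ := exists_isHullSet_ncard_eq_hnCC G
  have hsum : S.ncard + (S ∩ {u}).ncard = (S ∩ A).ncard + (S ∩ B).ncard := by
    rw [← Set.ncard_union_add_ncard_inter (S ∩ A), ← Set.inter_union_distrib_left,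
      ← Set.inter_inter_distrib_left, h.union_eq, h.inter_eq, Set.inter_univ]
  have hA := hnCC_le_ncard (h.isHullSet_insert hS)
  have hB := hnCC_le_ncard (h.symm.isHullSet_insert hS)
  rw [ncard_preimage_val] at hA hB
  by_cases hu : u ∈ S
  · rw [Set.insert_eq_of_mem hu] at hA hB
    rw [Set.inter_eq_right.2 (Set.singleton_subset_iff.2 hu), Set.ncard_singleton] at hsum
    omega
  · rw [Set.inter_singleton_eq_empty.2 hu, Set.ncard_empty] at hsum
    rw [Set.insert_inter_of_mem h.mem_left] at hA
    rw [Set.insert_inter_of_mem h.symm.mem_left] at hB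
    have hA' := Set.ncard_insert_le u (S ∩ A)
    have hB' := Set.ncard_insert_le u (S ∩ B)
    rcases h.isHullSet_or hS with h' | h'
    all_goals
      have := hnCC_le_ncard h'
      rw [ncard_preimage_val] at this
      omega

theorem hnCC_le_add_of_union_eq_univ {V : Type*} (G : SimpleGraph V) {A B : Set V}
    (h : A ∪ B = Set.univ) : hnCC G ≤ hnCC (G.induce A) + hnCC (G.induce B) := by
  obtain ⟨S₁, hc₁, hS₁⟩ := exists_isHullSet_ncard_eq_hnCC (G.induce A)
  obtain ⟨S₂, hc₂, hS₂⟩ := exists_isHullSet_ncard_eq_hnCC (G.induce B)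
  have hS : IsHullSet G (Subtype.val '' S₁ ∪ Subtype.val '' S₂) := by
    refine isHullSet_iff.2 fun T hST hT => ?_
    obtain ⟨hST₁, hST₂⟩ := Set.union_subset_iff.1 hST
    have h₁ := isHullSet_iff.1 hS₁ _ (Set.image_subset_iff.1 hST₁) (hT.induce A)
    have h₂ := isHullSet_iff.1 hS₂ _ (Set.image_subset_iff.1 hST₂) (hT.induce B)
    rw [← Set.univ_subset_iff, ← h]
    exact Set.union_subset (fun x hx => (Set.eq_univ_iff_forall.1 h₁ ⟨x, hx⟩ :))
      fun x hx => (Set.eq_univ_iff_forall.1 h₂ ⟨x, hx⟩ :)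
  calc hnCC G ≤ _ := hnCC_le_ncard hS
    _ ≤ _ := Set.ncard_union_le _ _
    _ = _ := by
      rw [Set.ncard_image_of_injective _ Subtype.val_injective,
        Set.ncard_image_of_injective _ Subtype.val_injective, hc₁, hc₂]

theorem isOneSeparation_of_connectedComponent {V : Type*} (G : SimpleGraph V) (u : V)
    (K : (G.induce ({u}ᶜ : Set V)).ConnectedComponent) :
    IsOneSeparation G u (Subtype.val '' K.supp ∪ {u}) (Subtype.val '' K.supp)ᶜ := by
  have hu : u ∉ Subtype.val '' K.supp := by
    rintro ⟨x, -, hx⟩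
    exact x.2 hx
  have hadj : ∀ x y, G.Adj x y → y ≠ u → x ∈ Subtype.val '' K.supp →
      y ∈ Subtype.val '' K.supp := by
    rintro _ y hxy hy ⟨x, hx, rfl⟩
    exact ⟨⟨y, hy⟩, K.mem_supp_of_adj_mem_supp hx (by simpa using hxy), rfl⟩
  refine ⟨?_, ?_, ?_, ?_⟩
  · rw [Set.union_right_comm, Set.union_compl_self, Set.univ_union]
  · ext x
    simp only [Set.mem_inter_iff, Set.mem_union, Set.mem_compl_iff, Set.mem_singleton_iff]
    constructor
    · tauto
    · rintro rfl
      exact ⟨Or.inr rfl, hu⟩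
  · intro x y hxy hx hxu
    by_cases hy : y = u
    · exact Or.inr hy
    · exact Or.inl (hadj x y hxy hy (hx.resolve_right hxu))
  · exact fun x y hxy hx hxu hy => hx (hadj y x hxy.symm hxu hy)

/-- For a cut-vertex `u` of a connected graph `G` and a connected component `C` of `G - u`,
with `G₁ = G[C ∪ {u}]` and `G₂ = G - C`, we have
`hn_cc(G₁) + hn_cc(G₂) - 1 ≤ hn_cc(G) ≤ hn_cc(G₁) + hn_cc(G₂)`. -/
theorem hnCC_cut_vertex_blocks {V : Type*} [Fintype V] (G : SimpleGraph V)
    (hconn : G.Connected) (u : V)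
    (hcut : Nat.card G.ConnectedComponent <
      Nat.card ((G.induce ({u}ᶜ : Set V)).ConnectedComponent))
    (C : Set V)
    (hC : ∃ K : (G.induce ({u}ᶜ : Set V)).ConnectedComponent, C = Subtype.val '' K.supp) :
    hnCC (G.induce (C ∪ {u})) + hnCC (G.induce (Cᶜ : Set V)) - 1 ≤ hnCC G ∧
    hnCC G ≤ hnCC (G.induce (C ∪ {u})) + hnCC (G.induce (Cᶜ : Set V)) := by
  obtain ⟨K, rfl⟩ := hC
  have h := isOneSeparation_of_connectedComponent G u K
  exact ⟨Nat.sub_le_iff_le_add.2 h.hnCC_add_le, hnCC_le_add_of_union_eq_univ G h.union_eq⟩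
end
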